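/- arXiv:2511.14020 — 4 statements merged into one kernel-verified Lean document; each statement's English description precedes it below -/
import Mathlib

section
/- Let A be a nontrivial uniform algebra on a compact Hausdorff space X. Then X has a nonempty perfect subset S (closed and without isolated points in the subspace topology) such that the restriction algebra A|S = {f restricted to S : f ∈ A} is a closed subalgebra of C(S, ℂ) with A|S ≠ C(S, ℂ), and A|S is antisymmetric on S, i.e., every f ∈ A whose restriction to S is real-valued is constant on S. -/
open scoped Topology

section UniformAlgebra

variable {X : Type*} [TopologicalSpace X]

/-- Every function in `A` that is bounded by `c` on `S` agrees on `S` with a function in `A`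
that is bounded by `c` on the whole space. -/
def HasBoundedExtensions (A : Subalgebra ℂ C(X, ℂ)) (S : Set X) : Prop :=
  ∀ f ∈ A, ∀ c : ℝ, 0 < c → (∀ x ∈ S, ‖f x‖ < c) →
    ∃ g ∈ A, (∀ x ∈ S, g x = f x) ∧ ∀ x, ‖g x‖ < c

/-- `A` is antisymmetric on `S`. -/
def IsAntisymmetricOn (A : Subalgebra ℂ C(X, ℂ)) (S : Set X) : Prop :=
  ∀ f ∈ A, (∀ x ∈ S, (f x).im = 0) → ∀ x ∈ S, ∀ y ∈ S, f x = f y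

/-- `K` is a boundary for the restriction of `A` to `S`. -/
def IsBoundaryFor (A : Subalgebra ℂ C(X, ℂ)) (S K : Set X) : Prop :=
  ∀ f ∈ A, ∀ x ∈ S, ∃ y ∈ K, ‖f x‖ ≤ ‖f y‖

variable {A : Subalgebra ℂ C(X, ℂ)} {S K : Set X}

theorem IsBoundaryFor.hasBoundedExtensions (hK : IsBoundaryFor A S K) (hKS : K ⊆ S)
    (hS : HasBoundedExtensions A S) : HasBoundedExtensions A K := by
  intro f hf c hc hfc
  obtain ⟨g, hg, hgf, hgc⟩ := hS f hf c hc fun x hx => by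
    obtain ⟨y, hy, hxy⟩ := hK f hf x hx
    exact hxy.trans_lt (hfc y hy)
  exact ⟨g, hg, fun x hx => hgf x (hKS hx), hgc⟩

theorem IsBoundaryFor.subsingleton (hsep : ∀ x y : X, x ≠ y → ∃ f ∈ A, f x ≠ f y)
    (hK : IsBoundaryFor A S K) (hsub : K.Subsingleton) : S.Subsingleton := by
  intro x hx y hy
  by_contra hxy
  obtain ⟨f, hf, hne⟩ := hsep x y hxy
  obtain ⟨z, hz, -⟩ := hK f hf x hx
  have hconst : ∀ w ∈ S, f w = f z := by
    intro w hw
    obtain ⟨v, hv, hwv⟩ := hK (f - algebraMap ℂ C(X, ℂ) (f z))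
      (A.sub_mem hf (A.algebraMap_mem _)) w hw
    rw [hsub hv hz] at hwv
    simpa [algebraMap_apply, sub_eq_zero] using hwv
  exact hne ((hconst x hx).trans (hconst y hy).symm)

variable [CompactSpace X]

/-- Uniform limits on `S` of functions in `A` are restrictions of functions in `A`. -/
theorem HasBoundedExtensions.exists_eq_of_forall_approx (hA : IsClosed (A : Set C(X, ℂ)))
    (hS : HasBoundedExtensions A S) (g : S → ℂ)
    (hg : ∀ ε : ℝ, 0 < ε → ∃ f ∈ A, ∀ x : S, ‖f x - g x‖ < ε) :
    ∃ f ∈ A, ∀ x : S, f x = g x := by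
  have hpos : ∀ n : ℕ, (0 : ℝ) < (1 / 2) ^ n := fun n => by positivity
  choose f hfA hf using fun n : ℕ => hg ((1 / 2) ^ n) (hpos n)
  have hdiff : ∀ n : ℕ, ∀ x ∈ S, ‖(f (n + 1) - f n) x‖ < 2 * (1 / 2) ^ n := by
    intro n x hx
    have h1 := hf n ⟨x, hx⟩
    have h2 := hf (n + 1) ⟨x, hx⟩
    have h3 : (f (n + 1) - f n) x = (f (n + 1) x - g ⟨x, hx⟩) - (f n x - g ⟨x, hx⟩) := by
      simp
    rw [h3]
    refine (norm_sub_le _ _).trans_lt ?_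
    have h4 : (1 / 2 : ℝ) ^ (n + 1) ≤ (1 / 2) ^ n := by
      rw [pow_succ]; linarith [hpos n]
    simp only at h1 h2
    linarith
  choose k hkA hkf hk using fun n : ℕ =>
    hS _ (A.sub_mem (hfA (n + 1)) (hfA n)) _ (mul_pos two_pos (hpos n)) (hdiff n)
  have hsum : Summable k := by
    refine Summable.of_norm_bounded (g := fun n : ℕ => 2 * (1 / 2 : ℝ) ^ n)
      (summable_geometric_two.mul_left 2) fun n => ?_
    exact (ContinuousMap.norm_le _ (mul_pos two_pos (hpos n)).le).2 fun x => (hk n x).le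
  have hlim := (hsum.hasSum.tendsto_sum_nat).const_add (f 0)
  refine ⟨f 0 + ∑' n, k n, ?_, fun x => ?_⟩
  · exact hA.mem_of_tendsto hlim (Filter.Eventually.of_forall fun n =>
      A.add_mem (hfA 0) (A.sum_mem fun i _ => hkA i))
  · have hval : ∀ n, (f 0 + ∑ i ∈ Finset.range n, k i) x = f n x := by
      intro n
      induction n with
      | zero => simp
      | succ n ih =>
        rw [Finset.sum_range_succ, ← add_assoc, ContinuousMap.add_apply, ih, hkf n x x.2]
        simp
    have h1 : Filter.Tendsto (fun n => f n x) Filter.atTop (𝓝 ((f 0 + ∑' n, k n) x)) := by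
      have := ((continuous_eval_const (x : X)).tendsto _).comp hlim
      simpa only [Function.comp_def, hval] using this
    have h2 : Filter.Tendsto (fun n => f n x) Filter.atTop (𝓝 (g x)) := by
      rw [tendsto_iff_norm_sub_tendsto_zero]
      exact squeeze_zero (fun _ => norm_nonneg _) (fun n => (hf n x).le)
        (tendsto_pow_atTop_nhds_zero_of_lt_one (by norm_num) (by norm_num))
    exact tendsto_nhds_unique h1 h2

theorem HasBoundedExtensions.isClosed_restrict (hA : IsClosed (A : Set C(X, ℂ)))
    (hSc : IsClosed S) (hS : HasBoundedExtensions A S) :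
    IsClosed {g : C(S, ℂ) | ∃ f ∈ A, g = f.restrict S} := by
  have : CompactSpace S := isCompact_iff_compactSpace.1 hSc.isCompact
  refine isClosed_of_closure_subset fun g hg => ?_
  obtain ⟨f, hf, hfg⟩ := hS.exists_eq_of_forall_approx hA g fun ε hε => by
    obtain ⟨_, ⟨f, hf, rfl⟩, hd⟩ := Metric.mem_closure_iff.1 hg ε hε
    refine ⟨f, hf, fun x => ?_⟩
    have := (ContinuousMap.dist_lt_iff hε).1 hd x
    rwa [dist_comm, dist_eq_norm] at this
  exact ⟨f, hf, ContinuousMap.ext fun x => (hfg x).symm⟩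

/-- Functional calculus for functions in `A` that are real-valued on `S`. -/
theorem HasBoundedExtensions.exists_eq_comp_re (hA : IsClosed (A : Set C(X, ℂ)))
    (hS : HasBoundedExtensions A S) {h : C(X, ℂ)} (hh : h ∈ A) (hre : ∀ x ∈ S, (h x).im = 0)
    {φ : ℝ → ℝ} (hφ : Continuous φ) :
    ∃ k ∈ A, ∀ x ∈ S, k x = (φ (h x).re : ℂ) := by
  obtain ⟨k, hk, hkφ⟩ := hS.exists_eq_of_forall_approx hA
    (fun x => (φ (h x).re : ℂ)) fun ε hε => by
      obtain ⟨p, hp⟩ := exists_polynomial_near_of_continuousOn (-‖h‖) ‖h‖ φ hφ.continuousOn ε hε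
      refine ⟨Polynomial.aeval h (p.map (algebraMap ℝ ℂ)), ?_, fun x => ?_⟩
      · exact Algebra.adjoin_le (Set.singleton_subset_iff.2 hh)
          (Polynomial.aeval_mem_adjoin_singleton ℂ h)
      · have h1 : (Polynomial.aeval h (p.map (algebraMap ℝ ℂ))) (x : X) =
            (p.map (algebraMap ℝ ℂ)).eval (h x) := by
          have := Polynomial.aeval_algHom_apply (ContinuousMap.evalAlgHom ℂ ℂ (x : X)) h
            (p.map (algebraMap ℝ ℂ))
          simpa [Polynomial.coe_aeval_eq_eval] using this.symm
        have h2 : h x = ((h x).re : ℂ) := Complex.ext rfl (by simpa using hre x x.2)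
        have h3 : (h x).re ∈ Set.Icc (-‖h‖) ‖h‖ :=
          abs_le.1 ((Complex.abs_re_le_norm _).trans (h.norm_coe_le_norm _))
        have h4 : (p.map (algebraMap ℝ ℂ)).eval (h x) = ((p.eval (h x).re : ℝ) : ℂ) := by
          conv_lhs => rw [h2]
          exact Polynomial.eval_map_apply (algebraMap ℝ ℂ) _
        rw [h1, h4, ← Complex.ofReal_sub, Complex.norm_real]
        exact hp _ h3
  exact ⟨k, hk, fun x hx => hkφ ⟨x, hx⟩⟩

theorem HasBoundedExtensions.inter_re_le (hA : IsClosed (A : Set C(X, ℂ))) (hSc : IsClosed S)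
    (hS : HasBoundedExtensions A S) {h : C(X, ℂ)} (hh : h ∈ A) (hre : ∀ x ∈ S, (h x).im = 0)
    (b : ℝ) : HasBoundedExtensions A (S ∩ {x | (h x).re ≤ b}) := by
  intro f hf c hc hfc
  have hcomp : IsCompact (S ∩ {x | c ≤ ‖f x‖}) :=
    (hSc.inter (isClosed_le continuous_const (by fun_prop))).isCompact
  obtain ⟨b', hbb', hb'⟩ := hcomp.exists_forall_le' (f := fun x => (h x).re) (a := b)
    (by fun_prop) fun x hx => by
      by_contra! hle
      exact absurd (hfc x ⟨hx.1, hle⟩) (not_lt.2 hx.2)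
  obtain ⟨k, hk, hkφ⟩ := hS.exists_eq_comp_re hA hh hre
    (φ := fun t => max 0 (min 1 ((b' - t) / (b' - b)))) (by fun_prop)
  have hb : 0 < b' - b := sub_pos.2 hbb'
  have hlt : ∀ x ∈ S, ‖(k * f) x‖ < c := by
    intro x hx
    rw [ContinuousMap.mul_apply, norm_mul, hkφ x hx, Complex.norm_real, Real.norm_eq_abs,
      abs_of_nonneg (le_max_left _ _)]
    by_cases hcx : c ≤ ‖f x‖
    · have h1 : (b' - (h x).re) / (b' - b) ≤ 0 :=
        div_nonpos_of_nonpos_of_nonneg (sub_nonpos.2 (hb' x ⟨hx, hcx⟩)) hb.le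
      rw [max_eq_left ((min_le_right _ _).trans h1), zero_mul]
      exact hc
    · refine (mul_le_of_le_one_left (norm_nonneg _) ?_).trans_lt (not_le.1 hcx)
      exact max_le zero_le_one (min_le_left _ _)
  obtain ⟨g, hg, hgk, hgc⟩ := hS _ (A.mul_mem hk hf) c hc hlt
  refine ⟨g, hg, fun x hx => ?_, hgc⟩
  have h1 : 1 ≤ (b' - (h x).re) / (b' - b) := by
    rw [one_le_div hb]
    linarith [show (h x).re ≤ b from hx.2]
  rw [hgk x hx.1, ContinuousMap.mul_apply, hkφ x hx.1, min_eq_left h1]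
  simp

/-- In a chain of closed sets, a neighbourhood of the intersection contains a member. -/
theorem IsChain.exists_subset_of_sInter_subset {c : Set (Set X)} (hc : IsChain (· ⊆ ·) c)
    (hne : c.Nonempty) (hcl : ∀ s ∈ c, IsClosed s) {U : Set X} (hU : IsOpen U)
    (h : ⋂₀ c ⊆ U) : ∃ s ∈ c, s ⊆ U := by
  have : Nonempty c := hne.to_subtype
  by_contra! hno
  have key := IsCompact.nonempty_iInter_of_directed_nonempty_isCompact_isClosed
    (fun s : c => (s : Set X) ∩ Uᶜ) (fun s t => by
      rcases hc.total s.2 t.2 with hst | hst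
      · exact ⟨s, subset_rfl, Set.inter_subset_inter_left _ hst⟩
      · exact ⟨t, Set.inter_subset_inter_left _ hst, subset_rfl⟩)
    (fun s => Set.inter_compl_nonempty_iff.2 (hno s s.2))
    (fun s => ((hcl s s.2).inter hU.isClosed_compl).isCompact)
    (fun s => (hcl s s.2).inter hU.isClosed_compl)
  obtain ⟨x, hx⟩ := key
  rw [Set.mem_iInter] at hx
  exact (hx (Classical.arbitrary c)).2 (h fun s hs => (hx ⟨s, hs⟩).1)

/-- A form of the Bishop–Machado theorem: a function outside `A` stays away from `A` on some
closed set with bounded extensions on which `A` is antisymmetric. -/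
theorem exists_isAntisymmetricOn_not_subsingleton (hA : IsClosed (A : Set C(X, ℂ)))
    (hA' : A ≠ ⊤) :
    ∃ S : Set X, IsClosed S ∧ HasBoundedExtensions A S ∧ IsAntisymmetricOn A S ∧
      ¬ S.Subsingleton := by
  obtain ⟨f, hf⟩ : ∃ f, f ∉ A := by
    by_contra! hall
    exact hA' (eq_top_iff.2 fun f _ => hall f)
  obtain ⟨d, hd, hball⟩ := Metric.isOpen_iff.1 hA.isOpen_compl f hf
  have hdist : ∀ g ∈ A, ∃ x ∈ Set.univ, d ≤ ‖g x - f x‖ := by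
    intro g hg
    by_contra! hlt
    refine hball (a := g) ?_ hg
    rw [Metric.mem_ball, ContinuousMap.dist_lt_iff hd]
    intro x
    rw [dist_eq_norm]
    exact hlt x trivial
  obtain ⟨S, -, hmin⟩ := zorn_superset_nonempty
    {S : Set X | IsClosed S ∧ HasBoundedExtensions A S ∧ ∀ g ∈ A, ∃ x ∈ S, d ≤ ‖g x - f x‖}
    (fun c hcF hc hne => by
      have hcl : ∀ s ∈ c, IsClosed s := fun s hs => (hcF hs).1
      refine ⟨⋂₀ c, ⟨isClosed_sInter hcl, ?_, ?_⟩, fun s hs => Set.sInter_subset_of_mem hs⟩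
      · intro u hu r hr hur
        obtain ⟨s, hs, hsU⟩ := hc.exists_subset_of_sInter_subset hne hcl
          (U := {x | ‖u x‖ < r}) (isOpen_lt (by fun_prop) continuous_const) hur
        obtain ⟨v, hv, hvu, hvr⟩ := (hcF hs).2.1 u hu r hr hsU
        exact ⟨v, hv, fun x hx => hvu x (hx s hs), hvr⟩
      · intro g hg
        by_contra! hlt
        obtain ⟨s, hs, hsU⟩ := hc.exists_subset_of_sInter_subset hne hcl
          (U := {x | ‖g x - f x‖ < d}) (isOpen_lt (by fun_prop) continuous_const) hlt
        obtain ⟨x, hx, hdx⟩ := (hcF hs).2.2 g hg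
        exact absurd (hsU hx) (not_lt.2 hdx))
    Set.univ ⟨isClosed_univ, fun u hu r _ hur => ⟨u, hu, fun _ _ => rfl, fun x => hur x trivial⟩,
      hdist⟩
  obtain ⟨hSc, hS, hSd⟩ := hmin.prop
  have hproper : ∀ T ⊆ S, IsClosed T → HasBoundedExtensions A T → (∃ x ∈ S, x ∉ T) →
      ∃ g ∈ A, ∀ x ∈ T, ‖g x - f x‖ < d := by
    rintro T hTS hTc hT ⟨x, hx, hxT⟩
    by_contra! hno
    exact hxT (hmin.le_of_le ⟨hTc, hT, hno⟩ hTS hx)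
  refine ⟨S, hSc, hS, ?_, fun hsub => ?_⟩
  · intro h hh hre
    have key : ∀ x ∈ S, ∀ y ∈ S, ¬ (h x).re < (h y).re := by
      intro x hx y hy hxy
      obtain ⟨a, hxa, hay⟩ := exists_between hxy
      obtain ⟨b, hab, hby⟩ := exists_between hay
      have hZeq : S ∩ {x | a ≤ (h x).re} = S ∩ {x | ((-h) x).re ≤ -a} := by
        ext z; simp
      obtain ⟨g₁, hg₁, hg₁d⟩ := hproper (S ∩ {x | (h x).re ≤ b}) Set.inter_subset_left
        (hSc.inter (isClosed_le (by fun_prop) continuous_const))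
        (hS.inter_re_le hA hSc hh hre b) ⟨y, hy, fun hmem => absurd hmem.2 (not_le.2 hby)⟩
      obtain ⟨g₂, hg₂, hg₂d⟩ := hproper (S ∩ {x | a ≤ (h x).re}) Set.inter_subset_left
        (hSc.inter (isClosed_le continuous_const (by fun_prop)))
        (hZeq ▸ hS.inter_re_le hA hSc (A.neg_mem hh) (fun z hz => by simp [hre z hz]) (-a))
        ⟨x, hx, fun hmem => absurd hmem.2 (not_le.2 hxa)⟩
      obtain ⟨k, hk, hkφ⟩ := hS.exists_eq_comp_re hA hh hre
        (φ := fun t => max 0 (min 1 ((b - t) / (b - a)))) (by fun_prop)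
      have hba : 0 < b - a := sub_pos.2 hab
      obtain ⟨z, hz, hdz⟩ := hSd (k * g₁ + (1 - k) * g₂)
        (A.add_mem (A.mul_mem hk hg₁) (A.mul_mem (A.sub_mem A.one_mem hk) hg₂))
      refine absurd hdz (not_le.2 ?_)
      have hkz := hkφ z hz
      set t : ℝ := max 0 (min 1 ((b - (h z).re) / (b - a))) with ht
      have ht0 : 0 ≤ t := le_max_left _ _
      have ht1 : t ≤ 1 := max_le zero_le_one (min_le_left _ _)
      have hsplit : (k * g₁ + (1 - k) * g₂) z - f z =
          (t : ℂ) * (g₁ z - f z) + ((1 - t : ℝ) : ℂ) * (g₂ z - f z) := by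
        simp only [ContinuousMap.add_apply, ContinuousMap.mul_apply, ContinuousMap.sub_apply,
          ContinuousMap.one_apply, hkz]
        push_cast
        ring
      rw [hsplit]
      have hb1 : b < (h z).re → t = 0 := fun hlt =>
        max_eq_left ((min_le_right _ _).trans
          (div_nonpos_of_nonpos_of_nonneg (by linarith) hba.le))
      have ha1 : (h z).re < a → t = 1 := fun hlt => by
        rw [ht, min_eq_left ((one_le_div hba).2 (by linarith)), max_eq_right zero_le_one]
      rcases lt_or_ge b (h z).re with hzb | hzb
      · simpa [hb1 hzb] using hg₂d z ⟨hz, (hab.trans hzb).le⟩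
      rcases lt_or_ge (h z).re a with hza | hza
      · simpa [ha1 hza] using hg₁d z ⟨hz, hzb⟩
      refine (norm_add_le _ _).trans_lt ?_
      rw [norm_mul, norm_mul, Complex.norm_real, Complex.norm_real, Real.norm_of_nonneg ht0,
        Real.norm_of_nonneg (sub_nonneg.2 ht1)]
      have h1 := hg₁d z ⟨hz, hzb⟩
      have h2 := hg₂d z ⟨hz, hza⟩
      rcases ht0.eq_or_lt with h0 | h0
      · rw [← h0]; simpa using h2
      · nlinarith [mul_lt_mul_of_pos_left h1 h0,
          mul_le_mul_of_nonneg_left h2.le (sub_nonneg.2 ht1)]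
    intro x hx y hy
    exact Complex.ext (le_antisymm (not_lt.1 (key y hy x hx)) (not_lt.1 (key x hx y hy)))
      ((hre x hx).trans (hre y hy).symm)
  · obtain ⟨x, hx, -⟩ := hSd 0 A.zero_mem
    obtain ⟨y, hy, hdy⟩ := hSd (algebraMap ℂ C(X, ℂ) (f x)) (A.algebraMap_mem _)
    rw [hsub hy hx] at hdy
    simp [algebraMap_apply] at hdy
    linarith

theorem IsBoundaryFor.im_eq_zero (hK : IsBoundaryFor A S K) {f : C(X, ℂ)} (hf : f ∈ A)
    (hre : ∀ x ∈ K, (f x).im = 0) : ∀ x ∈ S, (f x).im = 0 := by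
  intro x hx
  by_contra hne
  set b := (f x).im with hb
  -- for large real `t` of the sign of `b`, `f + i t` violates the boundary inequality at `x`
  obtain ⟨t, ht⟩ : ∃ t : ℝ, ‖f‖ ^ 2 < 2 * b * t :=
    ⟨(‖f‖ ^ 2 + 1) / (2 * b), by field_simp; linarith⟩
  obtain ⟨y, hy, hxy⟩ := hK (f + algebraMap ℂ C(X, ℂ) (t * Complex.I))
    (A.add_mem hf (A.algebraMap_mem _)) x hx
  have hsq := pow_le_pow_left₀ (norm_nonneg _) hxy 2
  simp only [ContinuousMap.add_apply, algebraMap_apply, ← Complex.normSq_eq_norm_sq,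
    Complex.normSq_apply] at hsq
  simp [hre y hy, ← hb] at hsq
  have h1 : |(f y).re| ≤ ‖f‖ := (Complex.abs_re_le_norm _).trans (f.norm_coe_le_norm y)
  have h2 := pow_le_pow_left₀ (abs_nonneg _) h1 2
  rw [sq_abs] at h2
  nlinarith [sq_nonneg b, sq_nonneg (f x).re]

theorem IsBoundaryFor.isAntisymmetricOn (hK : IsBoundaryFor A S K) (hKS : K ⊆ S)
    (hS : IsAntisymmetricOn A S) : IsAntisymmetricOn A K :=
  fun f hf hre x hx y hy => hS f hf (hK.im_eq_zero hf hre) x (hKS hx) y (hKS hy)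

theorem exists_minimal_isBoundaryFor (A : Subalgebra ℂ C(X, ℂ)) (hSc : IsClosed S) :
    ∃ K, K ⊆ S ∧ Minimal (fun K => IsClosed K ∧ IsBoundaryFor A S K) K := by
  obtain ⟨K, hKS, hK⟩ := zorn_superset_nonempty {K : Set X | IsClosed K ∧ IsBoundaryFor A S K}
    (fun c hcF hc hne => by
      have hcl : ∀ s ∈ c, IsClosed s := fun s hs => (hcF hs).1
      refine ⟨⋂₀ c, ⟨isClosed_sInter hcl, ?_⟩, fun s hs => Set.sInter_subset_of_mem hs⟩
      intro f hf x hx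
      by_contra! hlt
      obtain ⟨s, hs, hsU⟩ := hc.exists_subset_of_sInter_subset hne hcl
        (U := {y | ‖f y‖ < ‖f x‖}) (isOpen_lt (by fun_prop) continuous_const) hlt
      obtain ⟨y, hy, hxy⟩ := (hcF hs).2 f hf x hx
      exact absurd (hsU hy) (not_lt.2 hxy))
    S ⟨hSc, fun f _ x hx => ⟨x, hx, le_rfl⟩⟩
  exact ⟨K, hKS, hK⟩

/-- A minimal closed boundary on which `A` is antisymmetric has no isolated points unless it is
a point. -/
theorem neBot_nhdsNE_of_minimal_isBoundaryFor (hA : IsClosed (A : Set C(X, ℂ)))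
    (hK : Minimal (fun K => IsClosed K ∧ IsBoundaryFor A S K) K)
    (hext : HasBoundedExtensions A K) (hanti : IsAntisymmetricOn A K)
    (hsub : ¬ K.Subsingleton) (x : K) : (𝓝[≠] x).NeBot := by
  classical
  by_contra hbot
  rw [Filter.not_neBot, ← isOpen_singleton_iff_punctured_nhds] at hbot
  obtain ⟨U, hU, hUx⟩ := isOpen_induced_iff.1 hbot
  have hmemU : ∀ y : K, (y : X) ∈ U ↔ y = x := fun y => by
    rw [← Set.mem_preimage, hUx, Set.mem_singleton_iff]
  have hcl : IsClosed (K \ U) := hK.prop.1.sdiff hU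
  have hnot : ¬ IsBoundaryFor A S (K \ U) := fun hb =>
    (hK.le_of_le ⟨hcl, hb⟩ Set.sdiff_subset x.2).2 ((hmemU x).2 rfl)
  simp only [IsBoundaryFor] at hnot
  push Not at hnot
  obtain ⟨f, hf, w, hw, hlt⟩ := hnot
  obtain ⟨v, hv, hwv⟩ := hK.prop.2 f hf w hw
  have hvU : v ∈ U := by
    by_contra hvU
    exact absurd (hlt v ⟨hv, hvU⟩) (not_lt.2 hwv)
  have hvx : v = x := congrArg Subtype.val ((hmemU ⟨v, hv⟩).1 hvU)
  have hne : ∃ y ∈ K, y ≠ x := by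
    by_contra! hall
    exact hsub fun a ha b hb => (hall a ha).trans (hall b hb).symm
  obtain ⟨y, hy, hyx⟩ := hne
  have hyU : y ∉ U := fun h => hyx (congrArg Subtype.val ((hmemU ⟨y, hy⟩).1 h))
  have hfx : 0 < ‖f x‖ := hvx ▸ ((norm_nonneg _).trans_lt (hlt y ⟨hy, hyU⟩)).trans_le hwv
  have hfx0 : f x ≠ 0 := norm_pos_iff.1 hfx
  obtain ⟨z, hz, hmax⟩ := hcl.isCompact.exists_isMaxOn ⟨y, hy, hyU⟩
    (f := fun z => ‖f z‖) (by fun_prop)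
  set r : ℝ := ‖f z‖ / ‖f x‖ with hr
  have hr0 : 0 ≤ r := by positivity
  have hr1 : r < 1 := (div_lt_one hfx).2 (hvx ▸ (hlt z hz).trans_le hwv)
  obtain ⟨k, hk, hkx⟩ := hext.exists_eq_of_forall_approx hA
    (fun y => if y = x then 1 else 0) fun ε hε => by
      obtain ⟨n, hn⟩ := exists_pow_lt_of_lt_one hε hr1
      refine ⟨((f x)⁻¹ • f) ^ n, A.pow_mem (A.smul_mem hf _) n, fun u => ?_⟩
      by_cases hux : u = x
      · simpa [hux, inv_mul_cancel₀ hfx0] using hε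
      · simp only [hux, if_false, sub_zero, ContinuousMap.pow_apply, ContinuousMap.smul_apply,
          smul_eq_mul, norm_pow, norm_mul, norm_inv]
        refine (pow_le_pow_left₀ (by positivity) ?_ n).trans_lt hn
        rw [hr, div_eq_inv_mul]
        exact mul_le_mul_of_nonneg_left
          (hmax (show (u : X) ∈ K \ U from ⟨u.2, fun h => hux ((hmemU u).1 h)⟩))
          (by positivity)
  have hk1 := hkx x
  have hk0 := hkx ⟨y, hy⟩
  rw [if_pos rfl] at hk1
  rw [if_neg fun h => hyx (congrArg Subtype.val h)] at hk0
  have hkre : ∀ u ∈ K, (k u).im = 0 := fun u hu => by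
    rw [hkx ⟨u, hu⟩]
    split_ifs <;> simp
  have := hanti k hk hkre x x.2 y hy
  rw [hk1, show k y = 0 from hk0] at this
  exact one_ne_zero this

end UniformAlgebra

/-- Let `A` be a nontrivial uniform algebra on a compact Hausdorff space `X`.  Then `X` has a
nonempty perfect subset `S` such that the restriction `A|S` is a nontrivial closed subalgebra of
`C(S, ℂ)` and is antisymmetric: every `f ∈ A` that is real-valued on `S` is constant on `S`. -/
theorem stmt9 {X : Type*} [TopologicalSpace X] [CompactSpace X] [T2Space X]
    (A : Subalgebra ℂ C(X, ℂ)) (hA_closed : IsClosed (A : Set C(X, ℂ)))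
    (hA_sep : ∀ x y : X, x ≠ y → ∃ f ∈ A, f x ≠ f y)
    (hA_nontrivial : A ≠ ⊤) :
    ∃ S : Set X, S.Nonempty ∧ IsClosed S ∧ (∀ x : S, Filter.NeBot (𝓝[≠] x)) ∧
      IsClosed {g : C(S, ℂ) | ∃ f ∈ A, g = f.restrict S} ∧
      {g : C(S, ℂ) | ∃ f ∈ A, g = f.restrict S} ≠ Set.univ ∧
      (∀ f ∈ A, (∀ x ∈ S, (f x).im = 0) → ∀ x ∈ S, ∀ y ∈ S, f x = f y) := by
  obtain ⟨S, hSc, hS, hanti, hsub⟩ :=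
    exists_isAntisymmetricOn_not_subsingleton hA_closed hA_nontrivial
  obtain ⟨K, hKS, hK⟩ := exists_minimal_isBoundaryFor A hSc
  have hKsub : ¬ K.Subsingleton := fun h => hsub (hK.prop.2.subsingleton hA_sep h)
  have hKext := hK.prop.2.hasBoundedExtensions hKS hS
  have hKanti := hK.prop.2.isAntisymmetricOn hKS hanti
  refine ⟨K, (Set.not_subsingleton_iff.1 hKsub).nonempty, hK.prop.1,
    neBot_nhdsNE_of_minimal_isBoundaryFor hA_closed hK hKext hKanti hKsub,
    hKext.isClosed_restrict hA_closed hK.prop.1, fun huniv => ?_, hKanti⟩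
  obtain ⟨x, hx, y, hy, hxy⟩ := Set.not_subsingleton_iff.1 hKsub
  obtain ⟨u, hux, huy, -⟩ := exists_continuous_zero_one_of_isClosed
    (isClosed_singleton (x := x)) (isClosed_singleton (x := y)) (Set.disjoint_singleton.2 hxy)
  let v : C(X, ℂ) := ⟨fun z => (u z : ℂ), by fun_prop⟩
  obtain ⟨f, hf, hfv⟩ := huniv.ge (Set.mem_univ (v.restrict K))
  have hfu : ∀ z ∈ K, f z = (u z : ℂ) := fun z hz => (DFunLike.congr_fun hfv ⟨z, hz⟩).symm
  have := hKanti f hf (fun z hz => by simp [hfu z hz]) x hx y hy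
  rw [hfu x hx, hfu y hy, hux rfl, huy rfl] at this
  simp at this
end

section
/- Let X be a compact metrizable space. Then there is a countable collection J of pairs (K₁, K₂) of disjoint closed subsets of X such that for every pair (C₁, C₂) of disjoint closed subsets of X there is a pair (K₁, K₂) ∈ J with C₁ ⊆ K₁ and C₂ ⊆ K₂. -/
open TopologicalSpace in
/-- In a regular space, a compact subset of an open set `W` is covered by finitely many basic sets
whose union has closure contained in `W`. -/
theorem IsCompact.exists_finite_sUnion_closure_subset {X : Type*} [TopologicalSpace X]
    [RegularSpace X] {B : Set (Set X)} (hB : IsTopologicalBasis B) {C W : Set X}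
    (hC : IsCompact C) (hW : IsOpen W) (hCW : C ⊆ W) :
    ∃ F : Set (Set X), F.Finite ∧ F ⊆ B ∧ C ⊆ ⋃₀ F ∧ closure (⋃₀ F) ⊆ W := by
  have h : ∀ x ∈ C, ∃ U ∈ B, x ∈ U ∧ closure U ⊆ W := fun x hx =>
    hB.exists_closure_subset (hW.mem_nhds (hCW hx))
  choose! U hUB hxU hUW using h
  obtain ⟨t, htC, hCt⟩ := hC.elim_nhds_subcover U fun x hx =>
    (hB.isOpen (hUB x hx)).mem_nhds (hxU x hx)
  have hfin : (U '' (t : Set X)).Finite := t.finite_toSet.image U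
  refine ⟨U '' t, hfin, ?_, ?_, ?_⟩
  · rintro _ ⟨x, hx, rfl⟩
    exact hUB x (htC x hx)
  · simpa [Set.sUnion_image] using hCt
  · rw [hfin.closure_sUnion]
    simpa using fun x hx => hUW x (htC x hx)

/-- Let `X` be a compact metrizable space.  Then there is a countable collection `J` of pairs of
disjoint closed subsets of `X` such that every pair of disjoint closed subsets of `X` is
majorized by a member of `J`. -/
theorem stmt11 {X : Type*} [TopologicalSpace X] [CompactSpace X]
    [TopologicalSpace.MetrizableSpace X] :
    ∃ J : Set (Set X × Set X), J.Countable ∧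
      (∀ p ∈ J, IsClosed p.1 ∧ IsClosed p.2 ∧ Disjoint p.1 p.2) ∧
      ∀ C₁ C₂ : Set X, IsClosed C₁ → IsClosed C₂ → Disjoint C₁ C₂ →
        ∃ p ∈ J, C₁ ⊆ p.1 ∧ C₂ ⊆ p.2 := by
  let _ := TopologicalSpace.metrizableSpaceMetric X
  obtain ⟨B, hBc, -, hB⟩ := TopologicalSpace.exists_countable_basis X
  let S : Set (Set X) := (fun F => closure (⋃₀ F)) '' {F | F.Finite ∧ F ⊆ B}
  have hS : S.Countable := (Set.countable_ofPred_finite_subset hBc).image _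
  refine ⟨{p ∈ S ×ˢ S | Disjoint p.1 p.2}, (hS.prod hS).mono (Set.sep_subset _ _), ?_, ?_⟩
  · rintro ⟨_, _⟩ ⟨⟨⟨F, -, rfl⟩, ⟨G, -, rfl⟩⟩, hd⟩
    exact ⟨isClosed_closure, isClosed_closure, hd⟩
  · intro C₁ C₂ h₁ h₂ hd
    obtain ⟨U, V, hU, hV, hCU, hCV, hUV⟩ := normal_separation h₁ h₂ hd
    obtain ⟨F, hF, hFB, hCF, hFU⟩ :=
      h₁.isCompact.exists_finite_sUnion_closure_subset hB hU hCU
    obtain ⟨G, hG, hGB, hCG, hGV⟩ :=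
      h₂.isCompact.exists_finite_sUnion_closure_subset hB hV hCV
    exact ⟨(closure (⋃₀ F), closure (⋃₀ G)),
      ⟨⟨⟨F, ⟨hF, hFB⟩, rfl⟩, ⟨G, ⟨hG, hGB⟩, rfl⟩⟩, hUV.mono hFU hGV⟩,
      hCF.trans subset_closure, hCG.trans subset_closure⟩
end

section
/- Let X be a compact metric space and let (K_n)_{n≥1} be a sequence of pairwise disjoint, closed, nowhere dense subsets of X whose union is dense in X and whose diameters tend to 0. Then the set G = {f ∈ C(X, ℝ) : the restriction of f to K_n is constant for all but finitely many n} is dense in C(X, ℝ) with the supremum norm. -/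
open scoped Topology

section ClosedSetoid

variable {X : Type*} [TopologicalSpace X] [CompactSpace X]

/-- The projection of a compact space onto its quotient by a closed equivalence relation is a
closed map. -/
theorem Setoid.isClosedMap_mk_of_isClosed (s : Setoid X) (hs : IsClosed {p : X × X | s p.1 p.2}) :
    IsClosedMap (Quotient.mk s) := by
  intro C hC
  rw [← isQuotientMap_quotient_mk'.isClosed_preimage]
  convert isClosedMap_snd_of_compactSpace _ (hs.inter (hC.preimage continuous_fst)) using 1
  ext y
  constructor
  · rintro ⟨x, hx, hxy⟩
    exact ⟨(x, y), ⟨Quotient.exact hxy, hx⟩, rfl⟩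
  · rintro ⟨⟨x, z⟩, ⟨hxz, hx⟩, rfl⟩
    exact ⟨x, hx, Quotient.sound hxz⟩

/-- The quotient of a compact Hausdorff space by a closed equivalence relation is Hausdorff. -/
theorem Setoid.t2Space_quotient_of_isClosed [T2Space X] (s : Setoid X)
    (hs : IsClosed {p : X × X | s p.1 p.2}) : T2Space (Quotient s) := by
  have hmap := s.isClosedMap_mk_of_isClosed hs
  have hfib (y : Quotient s) : IsClosed (Quotient.mk s ⁻¹' {y}) := by
    obtain ⟨x, rfl⟩ := Quotient.exists_rep y
    have := (hmap {x} isClosed_singleton).preimage (continuous_quotient_mk' (s := s))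
    rwa [Set.image_singleton] at this
  rw [t2Space_iff_disjoint_nhds]
  intro y z hyz
  rw [← Filter.disjoint_comap_iff Quotient.mk_surjective,
    hmap.comap_nhds_eq continuous_quotient_mk', hmap.comap_nhds_eq continuous_quotient_mk']
  exact separatedNhds_iff_disjoint.1 <| normal_separation (hfib y) (hfib z) <|
    (Set.disjoint_singleton.2 hyz).preimage _


end ClosedSetoid

/-- A continuous function whose oscillation on each class of a closed equivalence relation is
less than `ε` is within `ε` of a continuous function which is constant on classes. -/
theorem Setoid.exists_continuousMap_dist_lt {X : Type*} [TopologicalSpace X] [CompactSpace X]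
    [T2Space X] (s : Setoid X) (hs : IsClosed {p : X × X | s p.1 p.2}) (f : C(X, ℝ)) {ε : ℝ}
    (hf : ∀ x y, s x y → dist (f x) (f y) < ε) :
    ∃ g : C(X, ℝ), (∀ x y, s x y → g x = g y) ∧ ∀ x, dist (g x) (f x) < ε := by
  have := s.t2Space_quotient_of_isClosed hs
  obtain ⟨g, hg⟩ := exists_continuous_forall_mem_convex_of_local_const
    (t := fun y : Quotient s => ⋂ x ∈ Quotient.mk s ⁻¹' {y}, Metric.ball (f x) ε)
    (fun y => convex_iInter₂ fun x _ => convex_ball _ _) (fun y => by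
      obtain ⟨x, rfl⟩ := Quotient.exists_rep y
      refine ⟨f x, ?_⟩
      have := (s.isClosedMap_mk_of_isClosed hs).eventually_nhds_fiber
        (p := fun z => dist (f x) (f z) < ε) (Quotient.mk s x) (fun z hz =>
          (continuous_const.dist f.continuous).continuousAt.eventually_lt_const
            (hf x z (Quotient.exact hz.symm)))
      filter_upwards [this] with y hy
      exact Set.mem_iInter₂.2 fun z hz => hy z hz)
  refine ⟨g.comp ⟨Quotient.mk s, continuous_quotient_mk'⟩, fun x y hxy => ?_, fun x => ?_⟩
  · exact congrArg g (Quotient.sound hxy)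
  · exact Set.mem_iInter₂.1 (hg (Quotient.mk s x)) x rfl

/-- The equivalence relation collapsing each member of a pairwise disjoint family of sets. -/
def Setoid.collapse {ι X : Type*} (K : ι → Set X) (hK : Pairwise (Function.onFun Disjoint K)) :
    Setoid X where
  r x y := x = y ∨ ∃ i, x ∈ K i ∧ y ∈ K i
  iseqv :=
    { refl := fun _ => Or.inl rfl
      symm := by
        rintro x y (rfl | ⟨i, hx, hy⟩)
        · exact Or.inl rfl
        · exact Or.inr ⟨i, hy, hx⟩
      trans := by
        rintro x y z (rfl | ⟨i, hx, hy⟩) (rfl | ⟨j, hy', hz⟩)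
        · exact Or.inl rfl
        · exact Or.inr ⟨j, hy', hz⟩
        · exact Or.inr ⟨i, hx, hy⟩
        · obtain rfl : i = j := hK.eq (Set.not_disjoint_iff.2 ⟨y, hy, hy'⟩)
          exact Or.inr ⟨i, hx, hz⟩ }

/-- Collapsing a null sequence of closed sets is a closed equivalence relation. -/
theorem Setoid.isClosed_collapse {X : Type*} [MetricSpace X] [CompactSpace X] (K : ℕ → Set X)
    (hK : Pairwise (Function.onFun Disjoint K)) (hc : ∀ n, IsClosed (K n))
    (hd : Filter.Tendsto (fun n => Metric.diam (K n)) Filter.atTop (𝓝 0)) :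
    IsClosed {p : X × X | Setoid.collapse K hK p.1 p.2} := by
  rw [← isOpen_compl_iff, isOpen_iff_mem_nhds]
  rintro ⟨x, y⟩ hxy
  have hxy' : ¬ (x = y ∨ ∃ i, x ∈ K i ∧ y ∈ K i) := hxy
  push Not at hxy'
  obtain ⟨hne, hnot⟩ := hxy'
  have hpos : 0 < dist x y := dist_pos.2 hne
  obtain ⟨N, hN⟩ := Filter.eventually_atTop.1 (hd.eventually_lt_const (half_pos hpos))
  have hfar : ∀ᶠ p : X × X in 𝓝 (x, y), dist x y / 2 < dist p.1 p.2 :=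
    continuous_dist.continuousAt.eventually_const_lt (half_lt_self hpos)
  have hfin : ∀ᶠ p : X × X in 𝓝 (x, y), ∀ n ∈ Finset.range N, p ∉ K n ×ˢ K n :=
    (Filter.eventually_all_finset _).2 fun n _ =>
      ((hc n).prod (hc n)).isOpen_compl.mem_nhds fun h => hnot n h.1 h.2
  filter_upwards [hfar, hfin] with p hp hpn
  rintro (h | ⟨n, h₁, h₂⟩)
  · rw [h, dist_self] at hp
    linarith
  · by_cases hn : n < N
    · exact hpn n (Finset.mem_range.2 hn) ⟨h₁, h₂⟩
    · have := Metric.dist_le_diam_of_mem (hc n).isCompact.isBounded h₁ h₂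
      linarith [hN n (not_lt.1 hn)]

/-- Let `X` be a compact metric space and `(Kₙ)` a sequence of pairwise disjoint, closed, nowhere
dense subsets of `X` whose union is dense and whose diameters tend to `0`.  Then the set of
continuous real-valued functions on `X` that are constant on `Kₙ` for all but finitely many `n`
is dense in `C(X, ℝ)`. -/
theorem stmt14 {X : Type*} [MetricSpace X] [CompactSpace X]
    (Kn : ℕ → Set X)
    (h_disj : ∀ m n, m ≠ n → Disjoint (Kn m) (Kn n))
    (h_closed : ∀ n, IsClosed (Kn n))
    (h_nwd : ∀ n, IsNowhereDense (Kn n))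
    (h_dense : Dense (⋃ n, Kn n))
    (h_diam : Filter.Tendsto (fun n => Metric.diam (Kn n)) Filter.atTop (𝓝 0)) :
    Dense {f : C(X, ℝ) | {n : ℕ | ¬ ∃ c : ℝ, ∀ x ∈ Kn n, f x = c}.Finite} := by
  rw [Metric.dense_iff]
  intro f ε hε
  obtain ⟨δ, hδ, hfδ⟩ := Metric.uniformContinuous_iff.1
    (CompactSpace.uniformContinuous_of_continuous f.continuous) ε hε
  obtain ⟨N, hN⟩ := Filter.eventually_atTop.1 (h_diam.eventually_lt_const hδ)
  have hK : Pairwise (Function.onFun Disjoint fun n => Kn (n + N)) :=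
    fun m n hmn => h_disj _ _ (by omega)
  obtain ⟨g, hg, hgf⟩ := (Setoid.collapse _ hK).exists_continuousMap_dist_lt
    (Setoid.isClosed_collapse _ hK (fun n => h_closed _)
      (h_diam.comp (Filter.tendsto_add_atTop_nat N))) f (ε := ε) (by
        rintro x y (rfl | ⟨n, hx, hy⟩)
        · rwa [dist_self]
        · exact hfδ ((Metric.dist_le_diam_of_mem (h_closed _).isCompact.isBounded hx hy).trans_lt
            (hN _ (Nat.le_add_left N n))))
  refine ⟨g, (ContinuousMap.dist_lt_iff hε).2 hgf,
    (Set.finite_lt_nat N).subset fun n hn => ?_⟩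
  by_contra hlt
  obtain ⟨m, rfl⟩ := Nat.exists_eq_add_of_le' (not_lt.1 hlt)
  refine hn ?_
  rcases (Kn (m + N)).eq_empty_or_nonempty with h | ⟨y, hy⟩
  · exact ⟨0, fun x hx => by simp [h] at hx⟩
  · exact ⟨g y, fun x hx => hg x y (Or.inr ⟨m, hx, hy⟩)⟩
end

section
/- Let X be a compact metrizable space without isolated points. Then every nonempty open subset U of X contains a subset C that is a Cantor set (in the subspace topology) and is nowhere dense in X. -/
open scoped Topology

/-- A subset `C` of a topological space is a Cantor set if, in the subspace topology, it is
nonempty, compact, metrizable, totally disconnected and without isolated points. -/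
def IsCantorSet {X : Type*} [TopologicalSpace X] (C : Set X) : Prop :=
  C.Nonempty ∧ IsCompact C ∧ TopologicalSpace.MetrizableSpace C ∧
    TotallyDisconnectedSpace C ∧ ∀ x : C, Filter.NeBot (𝓝[≠] x)

/-- Modifying a sequence at a single coordinate that tends to infinity converges to the
original sequence. -/
theorem tendsto_update_atTop_nhds {β : Type*} [TopologicalSpace β] (a : ℕ → β) (b : ℕ → β)
    {k : ℕ → ℕ} (hk : Filter.Tendsto k Filter.atTop Filter.atTop) :
    Filter.Tendsto (fun n => Function.update a (k n) (b n)) Filter.atTop (𝓝 a) := by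
  refine tendsto_pi_nhds.2 fun i => tendsto_const_nhds.congr' ?_
  filter_upwards [hk.eventually_gt_atTop i] with n hn
  exact (Function.update_of_ne hn.ne _ _).symm

/-- The range of a continuous injection of `ℕ → Bool` into a metrizable space is a Cantor set. -/
theorem isCantorSet_range {X : Type*} [TopologicalSpace X] [TopologicalSpace.MetrizableSpace X]
    {f : (ℕ → Bool) → X} (hf : Continuous f) (hinj : Function.Injective f) :
    IsCantorSet (Set.range f) := by
  refine ⟨Set.range_nonempty f, isCompact_range hf, inferInstance, ?_, ?_⟩
  · rw [totallyDisconnectedSpace_subtype_iff,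
      (hf.isClosedEmbedding hinj).isEmbedding.isTotallyDisconnected_range]
    infer_instance
  · rintro ⟨_, a, rfl⟩
    have ht : Filter.Tendsto (fun n => Set.rangeFactorization f (Function.update a n (!a n)))
        Filter.atTop (𝓝[≠] (Set.rangeFactorization f a)) := by
      refine tendsto_nhdsWithin_iff.2 ⟨?_, .of_forall fun n h => ?_⟩
      · exact (hf.rangeFactorization.tendsto a).comp
          (tendsto_update_atTop_nhds a _ Filter.tendsto_id)
      · have := congrFun (hinj (congrArg Subtype.val h)) n
        simp at this
    exact ht.neBot

/-- Spread a binary sequence over the even coordinates, filling the odd ones with `false`. -/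
def evenSpread (x : ℕ → Bool) (n : ℕ) : Bool := if Even n then x (n / 2) else false

theorem continuous_evenSpread : Continuous evenSpread := by
  refine continuous_pi fun n => ?_
  unfold evenSpread
  split_ifs <;> fun_prop

theorem evenSpread_injective : Function.Injective evenSpread := by
  intro x y h
  ext1 n
  simpa [evenSpread] using congrFun h (2 * n)

theorem interior_range_evenSpread : interior (Set.range evenSpread) = ∅ := by
  refine Set.eq_empty_of_forall_notMem fun a ha => ?_
  have hk : Filter.Tendsto (fun n : ℕ => 2 * n + 1) Filter.atTop Filter.atTop :=
    Filter.tendsto_atTop_mono (fun n => show n ≤ 2 * n + 1 by lia) Filter.tendsto_id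
  obtain ⟨n, x, hx⟩ := ((tendsto_update_atTop_nhds a (fun _ => true) hk).eventually
    (mem_interior_iff_mem_nhds.1 ha)).exists
  simpa [evenSpread] using congrFun hx (2 * n + 1)

/-- Let `X` be a compact metrizable space without isolated points.  Then every nonempty open
subset of `X` contains a nowhere dense Cantor set. -/
theorem stmt16 {X : Type*} [TopologicalSpace X] [CompactSpace X]
    [TopologicalSpace.MetrizableSpace X]
    (hX : ∀ x : X, Filter.NeBot (𝓝[≠] x))
    (U : Set X) (hU_open : IsOpen U) (hU_ne : U.Nonempty) :
    ∃ C : Set X, C ⊆ U ∧ IsCantorSet C ∧ IsNowhereDense C := by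
  let := TopologicalSpace.metrizableSpaceMetric X
  have : PerfectSpace X := perfectSpace_iff_forall_not_isolated.2 hX
  obtain ⟨x, hx⟩ := hU_ne
  obtain ⟨V, hV, hxV, hVU⟩ := isCompact_singleton.exists_isOpen_closure_subset
    (hU_open.mem_nhdsSet.2 (Set.singleton_subset_iff.2 hx))
  obtain ⟨f, hfV, hf, hinj⟩ := hV.perfect_closure.exists_nat_bool_injection
    ⟨x, subset_closure (hxV rfl)⟩
  have hg := hf.comp continuous_evenSpread
  refine ⟨Set.range (f ∘ evenSpread), ?_, isCantorSet_range hg (hinj.comp evenSpread_injective), ?_⟩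
  · exact (Set.range_comp_subset_range _ _).trans (hfV.trans hVU)
  · rw [(isCompact_range hg).isClosed.isNowhereDense_iff]
    refine Set.eq_empty_of_forall_notMem fun y hy => ?_
    obtain ⟨a, rfl⟩ := interior_subset hy
    have hmem : evenSpread a ∈ interior (Set.range evenSpread) := by
      refine interior_maximal ?_ (isOpen_interior.preimage hf) hy
      intro b hb
      obtain ⟨c, hc⟩ := interior_subset hb
      exact ⟨c, hinj hc⟩
    simp [interior_range_evenSpread] at hmem
end
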